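/- Let C be any of the trivial coefficient modules ℤ, ℤ/2, ℤ/3. Any injective group homomorphism ℤ/2 → A_4 into the alternating group A_4 induces an injection H_q(ℤ/2; C) → H_q(A_4; C) on group homology in every degree q ≥ 2, and induces the zero map on H_1. With trivial coefficients ℤ/4 the same holds in all degrees q ≠ 2, while any injective group homomorphism ℤ/2 → A_4 induces the zero map H_2(ℤ/2; ℤ/4) → H_2(A_4; ℤ/4). -/

import Mathlib

/-!
Group homology via the inhomogeneous bar complex (trivial coefficients).
-/

namespace BarHomology

/-- The `n`-th term of the inhomogeneous bar complex of `G` with trivial coefficients in `A`. -/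
abbrev chains (G : Type) (A : Type) [AddCommGroup A] (n : ℕ) : Type := (Fin n → G) →₀ A

/-- The differential of the inhomogeneous bar complex with trivial coefficients:
`d (g₁, …, g_{n+1}) = (g₂, …, g_{n+1}) + ∑_{j=1}^{n} (-1)^j (g₁, …, g_j g_{j+1}, …, g_{n+1})
  + (-1)^{n+1} (g₁, …, g_n)`. -/
noncomputable def d (k : Type) [CommRing k] (G : Type) [Group G] (A : Type) [AddCommGroup A]
    [Module k A] (n : ℕ) : chains G A (n + 1) →ₗ[k] chains G A n :=
  Finsupp.lsum k fun g =>
    (Finsupp.lsingle (fun i => g i.succ) : A →ₗ[k] chains G A n)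
      + ∑ j : Fin (n + 1),
          ((-1 : k) ^ ((j : ℕ) + 1)) • (Finsupp.lsingle (Fin.contractNth j (· * ·) g))

/-- The cycles: everything in degree `0`, the kernel of the differential in positive degrees. -/
noncomputable def cycles (k : Type) [CommRing k] (G : Type) [Group G] (A : Type) [AddCommGroup A]
    [Module k A] : (n : ℕ) → Submodule k (chains G A n)
  | 0 => ⊤
  | (n + 1) => LinearMap.ker (d k G A n)

/-- The boundaries, viewed as a submodule of the cycles. -/
noncomputable def boundariesIn (k : Type) [CommRing k] (G : Type) [Group G] (A : Type)
    [AddCommGroup A] [Module k A] (n : ℕ) : Submodule k (cycles k G A n) :=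
  (LinearMap.range (d k G A n)).comap (cycles k G A n).subtype

/-- Group homology of `G` in degree `n` with trivial coefficients in the `k`-module `A`,
defined as cycles modulo boundaries in the inhomogeneous bar complex. -/
abbrev GroupHomology (k : Type) [CommRing k] (G : Type) [Group G] (A : Type) [AddCommGroup A]
    [Module k A] (n : ℕ) : Type :=
  ↥(cycles k G A n) ⧸ boundariesIn k G A n

section Maps

variable {k : Type} [CommRing k] {G G' : Type} [Group G] [Group G'] {A : Type} [AddCommGroup A]
  [Module k A]

/-- The chain map induced by a group homomorphism. -/
noncomputable def chainsMap (k : Type) [CommRing k] (A : Type) [AddCommGroup A] [Module k A]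
    (φ : G →* G') (n : ℕ) : chains G A n →ₗ[k] chains G' A n :=
  Finsupp.lmapDomain A k (fun f => φ ∘ f)

lemma comp_contractNth (φ : G →* G') {n : ℕ} (j : Fin (n + 1)) (g : Fin (n + 1) → G) :
    φ ∘ Fin.contractNth j (· * ·) g = Fin.contractNth j (· * ·) (φ ∘ g) := by
  funext i
  rcases lt_trichotomy (i : ℕ) (j : ℕ) with h | h | h
  · simp [Function.comp_apply, Fin.contractNth_apply_of_lt _ _ _ _ h]
  · simp [Function.comp_apply, Fin.contractNth_apply_of_eq _ _ _ _ h, map_mul]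
  · simp [Function.comp_apply, Fin.contractNth_apply_of_gt _ _ _ _ h]

lemma chainsMap_comm (φ : G →* G') (n : ℕ) :
    (d k G' A n).comp (chainsMap k A φ (n + 1))
      = (chainsMap k A φ n).comp (d k G A n) := by
  apply Finsupp.lhom_ext
  intro g a
  simp only [LinearMap.comp_apply, chainsMap, Finsupp.lmapDomain_apply, Finsupp.mapDomain_single,
    d, Finsupp.lsum_single, LinearMap.add_apply, LinearMap.sum_apply, LinearMap.smul_apply,
    Finsupp.lsingle_apply, map_add, map_sum, map_smul]
  congr 1
  refine Finset.sum_congr rfl fun j _ => ?_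
  rw [comp_contractNth]

lemma chainsMap_mem_cycles (φ : G →* G') {n : ℕ} {x : chains G A n}
    (hx : x ∈ cycles k G A n) : chainsMap k A φ n x ∈ cycles k G' A n := by
  cases n with
  | zero => trivial
  | succ n =>
    simp only [cycles, LinearMap.mem_ker] at hx ⊢
    have := LinearMap.congr_fun (chainsMap_comm (k := k) (A := A) φ n) x
    simp only [LinearMap.comp_apply] at this
    rw [this, hx, map_zero]

/-- The map induced by a group homomorphism on cycles. -/
noncomputable def cyclesMap (k : Type) [CommRing k] (A : Type) [AddCommGroup A] [Module k A]
    (φ : G →* G') (n : ℕ) : ↥(cycles k G A n) →ₗ[k] ↥(cycles k G' A n) :=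
  (chainsMap k A φ n).restrict fun _ hx => chainsMap_mem_cycles φ hx

/-- The map induced by a group homomorphism on group homology with trivial coefficients. -/
noncomputable def inducedMap (k : Type) [CommRing k] (A : Type) [AddCommGroup A] [Module k A]
    (φ : G →* G') (n : ℕ) :
    GroupHomology k G A n →ₗ[k] GroupHomology k G' A n :=
  Submodule.mapQ (boundariesIn k G A n) (boundariesIn k G' A n) (cyclesMap k A φ n) (by
    rintro ⟨x, hx⟩ hb
    simp only [boundariesIn, Submodule.mem_comap, Submodule.subtype_apply,
      LinearMap.mem_range] at hb ⊢
    obtain ⟨w, hw⟩ := hb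
    refine ⟨chainsMap k A φ (n + 1) w, ?_⟩
    have := LinearMap.congr_fun (chainsMap_comm (k := k) (A := A) φ n) w
    simp only [LinearMap.comp_apply] at this
    rw [this, hw]
    rfl)

end Maps

end BarHomology

open BarHomology

namespace BarHomology

section Normalization

variable {k : Type} [CommRing k] {G : Type} [Group G] {A : Type} [AddCommGroup A] [Module k A]

/-- The entries of a tuple, continued by `1` beyond its length. -/
def extendOne {n : ℕ} (g : Fin n → G) (i : ℕ) : G := if h : i < n then g ⟨i, h⟩ else 1

/-- The `j`-th face of a bar simplex, for `j ≤ n + 1`. -/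
def face {n : ℕ} (j : ℕ) (g : Fin (n + 1) → G) (i : Fin n) : G :=
  if (i : ℕ) + 1 < j then extendOne g i
  else if (i : ℕ) + 1 = j then extendOne g i * extendOne g (i + 1)
  else extendOne g (i + 1)

/-- The `i`-th degeneracy of a bar simplex, for `i ≤ n`: the insertion of `1` at place `i`. -/
def degen {n : ℕ} (i : ℕ) (g : Fin n → G) (l : Fin (n + 1)) : G :=
  if (l : ℕ) < i then extendOne g l
  else if (l : ℕ) = i then 1
  else extendOne g (l - 1)

lemma extendOne_of_lt {n : ℕ} (g : Fin n → G) {i : ℕ} (h : i < n) : extendOne g i = g ⟨i, h⟩ :=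
  dif_pos h

lemma extendOne_of_le {n : ℕ} (g : Fin n → G) {i : ℕ} (h : n ≤ i) : extendOne g i = 1 :=
  dif_neg (by omega)

lemma extendOne_face {n j : ℕ} (g : Fin (n + 1) → G) {i : ℕ} (hi : i < n) :
    extendOne (face j g) i =
      if i + 1 < j then extendOne g i
      else if i + 1 = j then extendOne g i * extendOne g (i + 1)
      else extendOne g (i + 1) :=
  extendOne_of_lt _ hi

lemma extendOne_degen {n i : ℕ} (hi : i ≤ n) (g : Fin n → G) (l : ℕ) :
    extendOne (degen i g) l =
      if l < i then extendOne g l else if l = i then 1 else extendOne g (l - 1) := by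
  rcases lt_or_ge l (n + 1) with h | h
  · exact extendOne_of_lt _ h
  · rw [extendOne_of_le _ h, if_neg (by omega), if_neg (by omega), extendOne_of_le _ (by omega)]

lemma face_zero {n : ℕ} (g : Fin (n + 1) → G) : face 0 g = fun i => g i.succ := by
  funext i
  simp only [face, Nat.not_lt_zero, if_false, Nat.succ_ne_zero]
  exact extendOne_of_lt g (by omega)

lemma face_succ {n : ℕ} (j : Fin (n + 1)) (g : Fin (n + 1) → G) :
    face ((j : ℕ) + 1) g = Fin.contractNth j (· * ·) g := by
  funext i
  have h₀ : extendOne g i = g i.castSucc := extendOne_of_lt g (by omega)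
  have h₁ : extendOne g (i + 1) = g i.succ := extendOne_of_lt g (by omega)
  simp only [face, Fin.contractNth, h₀, h₁, Nat.add_lt_add_iff_right, Nat.add_right_cancel_iff]

lemma face_degen_of_lt {n i j : ℕ} (hij : j < i + 1) (hi : i ≤ n) (g : Fin (n + 1) → G) :
    face j (degen (i + 1) g) = degen i (face j g) := by
  funext l
  simp only [face, degen, extendOne_degen (show i + 1 ≤ n + 1 by omega)]
  rcases lt_trichotomy (l : ℕ) i with h | h | h
  · rw [extendOne_face _ (by omega)]
    split_ifs <;> first | rfl | omega
  · split_ifs <;> first | rfl | omega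
  · rw [extendOne_face (i := l - 1) _ (by omega)]
    have : (l : ℕ) - 1 + 1 = l := by omega
    rw [this]
    split_ifs <;> first | rfl | omega

lemma face_degen_self {n i j : ℕ} (hj : j = i ∨ j = i + 1) (hi : i ≤ n) (g : Fin n → G) :
    face j (degen i g) = g := by
  funext l
  have hl : extendOne g l = g l := extendOne_of_lt g l.2
  simp only [face, extendOne_degen hi, Nat.add_sub_cancel]
  split_ifs <;> first | omega | simp [hl]

lemma face_degen_of_gt {n i j : ℕ} (hij : i < j) (hj : j ≤ n + 1) (g : Fin (n + 1) → G) :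
    face (j + 1) (degen i g) = degen i (face j g) := by
  funext l
  simp only [face, degen, extendOne_degen (show i ≤ n + 1 by omega), Nat.add_sub_cancel]
  rcases lt_trichotomy (l : ℕ) i with h | h | h
  · rw [extendOne_face _ (by omega)]
    split_ifs <;> first | rfl | omega
  · split_ifs <;> first | rfl | omega
  · rw [extendOne_face (i := l - 1) _ (by omega)]
    have : (l : ℕ) - 1 + 1 = l := by omega
    rw [this]
    split_ifs <;> first | rfl | omega

lemma degen_degen {n i j : ℕ} (hij : i ≤ j) (hj : j ≤ n) (g : Fin n → G) :
    degen (j + 1) (degen i g) = degen i (degen j g) := by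
  funext l
  simp only [degen, extendOne_degen hj, extendOne_degen (hij.trans hj)]
  split_ifs <;> first | rfl | omega

variable (k A) in
/-- The `j`-th face operator on bar chains. -/
noncomputable def faceMap (n j : ℕ) : chains G A (n + 1) →ₗ[k] chains G A n :=
  Finsupp.lmapDomain A k (face j)

variable (k A) in
/-- The `i`-th degeneracy operator on bar chains. -/
noncomputable def degenMap (n i : ℕ) : chains G A n →ₗ[k] chains G A (n + 1) :=
  Finsupp.lmapDomain A k (degen i)

@[simp]
lemma faceMap_single (n j : ℕ) (g : Fin (n + 1) → G) (a : A) :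
    faceMap k A n j (Finsupp.single g a) = Finsupp.single (face j g) a :=
  Finsupp.mapDomain_single

@[simp]
lemma degenMap_single (n i : ℕ) (g : Fin n → G) (a : A) :
    degenMap k A n i (Finsupp.single g a) = Finsupp.single (degen i g) a :=
  Finsupp.mapDomain_single

lemma d_single (n : ℕ) (g : Fin (n + 1) → G) (a : A) :
    d k G A n (Finsupp.single g a) = Finsupp.single (fun i => g i.succ) a +
      ∑ j : Fin (n + 1), (-1 : k) ^ ((j : ℕ) + 1) •
        Finsupp.single (Fin.contractNth j (· * ·) g) a := by
  simp [d]

lemma d_eq_sum_faceMap (n : ℕ) (x : chains G A (n + 1)) :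
    d k G A n x = ∑ j ∈ Finset.range (n + 2), (-1 : k) ^ j • faceMap k A n j x := by
  suffices d k G A n = ∑ j ∈ Finset.range (n + 2), (-1 : k) ^ j • faceMap k A n j by
    simp [this]
  refine Finsupp.lhom_ext fun g a => ?_
  rw [d_single, Finset.sum_range_succ', Finset.sum_range, add_comm]
  simp [← face_zero, ← face_succ]

lemma faceMap_degenMap_of_lt {n i j : ℕ} (hij : j < i + 1) (hi : i ≤ n)
    (x : chains G A (n + 1)) :
    faceMap k A (n + 1) j (degenMap k A (n + 1) (i + 1) x) =
      degenMap k A n i (faceMap k A n j x) := by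
  induction x using Finsupp.induction_linear with
  | zero => simp
  | add x y hx hy => simp [hx, hy]
  | single g a => simp [face_degen_of_lt hij hi]

lemma faceMap_degenMap_self {n i j : ℕ} (hj : j = i ∨ j = i + 1) (hi : i ≤ n)
    (x : chains G A n) : faceMap k A n j (degenMap k A n i x) = x := by
  induction x using Finsupp.induction_linear with
  | zero => simp
  | add x y hx hy => simp [hx, hy]
  | single g a => simp [face_degen_self hj hi]

lemma faceMap_degenMap_of_gt {n i j : ℕ} (hij : i < j) (hj : j ≤ n + 1)
    (x : chains G A (n + 1)) :
    faceMap k A (n + 1) (j + 1) (degenMap k A (n + 1) i x) =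
      degenMap k A n i (faceMap k A n j x) := by
  induction x using Finsupp.induction_linear with
  | zero => simp
  | add x y hx hy => simp [hx, hy]
  | single g a => simp [face_degen_of_gt hij hj]

lemma degenMap_degenMap {n i j : ℕ} (hij : i ≤ j) (hj : j ≤ n) (x : chains G A n) :
    degenMap k A (n + 1) (j + 1) (degenMap k A n i x) =
      degenMap k A (n + 1) i (degenMap k A n j x) := by
  induction x using Finsupp.induction_linear with
  | zero => simp
  | add x y hx hy => simp [hx, hy]
  | single g a => simp [degen_degen hij hj]

variable (k G A) in
/-- The chains spanned by the simplices that have an entry `1` at one of the first `m` places. -/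
noncomputable def degenerate (n m : ℕ) : Submodule k (chains G A (n + 1)) :=
  ⨆ i ∈ Finset.range m, LinearMap.range (degenMap k A n i)

lemma degenMap_mem_degenerate {n m i : ℕ} (hi : i < m) (x : chains G A n) :
    degenMap k A n i x ∈ degenerate k G A n m :=
  Submodule.mem_iSup_of_mem i (Submodule.mem_iSup_of_mem (Finset.mem_range.2 hi) ⟨x, rfl⟩)

lemma degenerate_le {n m : ℕ} {S : Submodule k (chains G A (n + 1))}
    (h : ∀ i < m, ∀ x, degenMap k A n i x ∈ S) : degenerate k G A n m ≤ S := by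
  refine iSup₂_le fun i hi => ?_
  rintro _ ⟨x, rfl⟩
  exact h i (Finset.mem_range.1 hi) x

lemma single_mem_degenerate {n : ℕ} (g : Fin (n + 1) → G) (a : A) (i : Fin (n + 1))
    (hg : g i = 1) : Finsupp.single g a ∈ degenerate k G A n (n + 1) := by
  have : degen (i : ℕ) (fun l => g (i.succAbove l)) = g := by
    funext l
    rcases lt_trichotomy l i with h | h | h
    · have h' : (l : ℕ) < i := h
      have hl : (l : ℕ) < n := by omega
      simp only [degen, if_pos h', extendOne_of_lt _ hl]
      congr 1
      rw [Fin.succAbove_of_castSucc_lt _ _ h]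
      rfl
    · subst h
      simp [degen, hg]
    · have h' : (i : ℕ) < l := h
      have hl : (l : ℕ) - 1 < n := by omega
      simp only [degen, if_neg (show ¬ (l : ℕ) < i by omega),
        if_neg (show ¬ (l : ℕ) = i by omega), extendOne_of_lt _ hl]
      congr 1
      rw [Fin.succAbove_of_le_castSucc _ _ (by rw [Fin.le_def]; simp; omega)]
      ext
      simp
      omega
  rw [← this, ← degenMap_single (k := k)]
  exact degenMap_mem_degenerate i.2 _

lemma d_degenMap_add_degenMap_d {n m : ℕ} (hm : m ≤ n + 1) (x : chains G A (n + 1)) :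
    d k G A (n + 1) (degenMap k A (n + 1) m x) + degenMap k A n m (d k G A n x) =
      (∑ j ∈ Finset.range m, (-1 : k) ^ j • degenMap k A n (m - 1) (faceMap k A n j x)) +
        ∑ j ∈ Finset.range (m + 1), (-1 : k) ^ j • degenMap k A n m (faceMap k A n j x) := by
  have hn : Finset.range (n + 1 + 2) = Finset.range (m + 1 + 1 + (n + 1 - m)) := by
    congr 1
    omega
  have hn' : Finset.range (n + 2) = Finset.range (m + 1 + (n + 1 - m)) := by
    congr 1
    omega
  have hlow : ∀ j ∈ Finset.range m,
      (-1 : k) ^ j • faceMap k A (n + 1) j (degenMap k A (n + 1) m x) =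
        (-1 : k) ^ j • degenMap k A n (m - 1) (faceMap k A n j x) := by
    intro j hj
    rw [Finset.mem_range] at hj
    obtain ⟨i, rfl⟩ : ∃ i, m = i + 1 := ⟨m - 1, by omega⟩
    rw [faceMap_degenMap_of_lt hj (by omega), Nat.add_sub_cancel]
  have hhigh : ∀ j ∈ Finset.range (n + 1 - m),
      (-1 : k) ^ (m + 1 + 1 + j) •
          faceMap k A (n + 1) (m + 1 + 1 + j) (degenMap k A (n + 1) m x) =
        -((-1 : k) ^ (m + 1 + j) • degenMap k A n m (faceMap k A n (m + 1 + j) x)) := by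
    intro j hj
    rw [Finset.mem_range] at hj
    rw [show m + 1 + 1 + j = (m + 1 + j) + 1 by omega,
      faceMap_degenMap_of_gt (by omega) (by omega), pow_succ]
    simp
  rw [d_eq_sum_faceMap, d_eq_sum_faceMap, hn, hn', Finset.sum_range_add, Finset.sum_range_succ,
    Finset.sum_range_succ, Finset.sum_congr rfl hlow, Finset.sum_congr rfl hhigh,
    faceMap_degenMap_self (Or.inl rfl) hm, faceMap_degenMap_self (Or.inr rfl) hm,
    Finset.sum_range_add _ (m + 1)]
  simp only [map_add, map_sum, map_smul, Finset.sum_neg_distrib, pow_succ, mul_neg, mul_one,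
    neg_smul]
  abel

lemma d_degenMap_mem_degenerate {n m : ℕ} (hm : m ≤ n + 1) (x : chains G A (n + 1)) :
    d k G A (n + 1) (degenMap k A (n + 1) m x) ∈ degenerate k G A n (m + 1) := by
  rw [eq_sub_of_add_eq (d_degenMap_add_degenMap_d hm x)]
  refine sub_mem (add_mem (sum_mem fun j hj => ?_) (sum_mem fun j hj => ?_)) ?_
  · exact Submodule.smul_mem _ _ (degenMap_mem_degenerate (by omega) _)
  · exact Submodule.smul_mem _ _ (degenMap_mem_degenerate (by omega) _)
  · exact degenMap_mem_degenerate (by omega) _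

lemma degenMap_sum_faceMap_degenMap_mem {n m i : ℕ} (hi : i < m) (hm : m ≤ n) (y : chains G A n) :
    ∑ j ∈ Finset.range (m + 1), (-1 : k) ^ j • degenMap k A n m
      (faceMap k A n j (degenMap k A n i y)) ∈ degenerate k G A n m := by
  obtain ⟨n, rfl⟩ : ∃ l, n = l + 1 := ⟨n - 1, by omega⟩
  obtain ⟨m, rfl⟩ : ∃ l, m = l + 1 := ⟨m - 1, by omega⟩
  have hn : m + 1 + 1 = i + 1 + 1 + (m - i) := by omega
  rw [hn, Finset.sum_range_add, Finset.sum_range_succ, Finset.sum_range_succ,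
    faceMap_degenMap_self (Or.inl rfl) (by omega), faceMap_degenMap_self (Or.inr rfl) (by omega),
    pow_succ, mul_neg_one, neg_smul, add_neg_cancel_right]
  refine add_mem (sum_mem fun j hj => ?_) (sum_mem fun j hj => ?_)
  · rw [Finset.mem_range] at hj
    obtain ⟨i, rfl⟩ : ∃ l, i = l + 1 := ⟨i - 1, by omega⟩
    rw [faceMap_degenMap_of_lt hj (by omega), degenMap_degenMap (by omega) (by omega)]
    exact Submodule.smul_mem _ _ (degenMap_mem_degenerate (by omega) _)
  · rw [Finset.mem_range] at hj
    rw [show i + 1 + 1 + j = (i + 1 + j) + 1 by omega,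
      faceMap_degenMap_of_gt (by omega) (by omega), degenMap_degenMap (by omega) (by omega)]
    exact Submodule.smul_mem _ _ (degenMap_mem_degenerate (by omega) _)

lemma degenMap_sum_faceMap_degenMap_self_sub_mem {n m : ℕ} (hm : m ≤ n) (y : chains G A n) :
    ∑ j ∈ Finset.range (m + 1), (-1 : k) ^ j • degenMap k A n m
      (faceMap k A n j (degenMap k A n m y)) - (-1 : k) ^ m • degenMap k A n m y ∈
        degenerate k G A n m := by
  rw [Finset.sum_range_succ, faceMap_degenMap_self (Or.inl rfl) hm, add_sub_cancel_right]
  refine sum_mem fun j hj => ?_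
  rw [Finset.mem_range] at hj
  obtain ⟨n, rfl⟩ : ∃ l, n = l + 1 := ⟨n - 1, by omega⟩
  obtain ⟨m, rfl⟩ : ∃ l, m = l + 1 := ⟨m - 1, by omega⟩
  rw [faceMap_degenMap_of_lt hj (by omega), degenMap_degenMap le_rfl (by omega)]
  exact Submodule.smul_mem _ _ (degenMap_mem_degenerate (by omega) _)

lemma d_degenMap_add_degenMap_d_sub_mem {n m : ℕ} (hm : m ≤ n) {x : chains G A (n + 1)}
    (hx : x ∈ degenerate k G A n (m + 1)) :
    d k G A (n + 1) (degenMap k A (n + 1) m x) + degenMap k A n m (d k G A n x) -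
      (-1 : k) ^ m • x ∈ degenerate k G A n m := by
  let T : chains G A (n + 1) →ₗ[k] chains G A (n + 1) :=
    d k G A (n + 1) ∘ₗ degenMap k A (n + 1) m + degenMap k A n m ∘ₗ d k G A n -
      (-1 : k) ^ m • LinearMap.id
  suffices degenerate k G A n (m + 1) ≤ (degenerate k G A n m).comap T from this hx
  refine degenerate_le fun i hi y => ?_
  change d k G A (n + 1) (degenMap k A (n + 1) m (degenMap k A n i y)) +
    degenMap k A n m (d k G A n (degenMap k A n i y)) - (-1 : k) ^ m • degenMap k A n i y ∈
      degenerate k G A n m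
  rw [d_degenMap_add_degenMap_d (by omega), add_sub_assoc]
  refine add_mem (sum_mem fun j hj => ?_) ?_
  · rw [Finset.mem_range] at hj
    exact Submodule.smul_mem _ _ (degenMap_mem_degenerate (by omega) _)
  · rcases Nat.lt_succ_iff_lt_or_eq.1 hi with h | rfl
    · exact sub_mem (degenMap_sum_faceMap_degenMap_mem h hm y)
        (Submodule.smul_mem _ _ (degenMap_mem_degenerate h _))
    · exact degenMap_sum_faceMap_degenMap_self_sub_mem hm y

lemma d_d (n : ℕ) (x : chains G A (n + 2)) : d k G A n (d k G A (n + 1) x) = 0 := by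
  have h (n : ℕ) : d k G A n =
      (groupHomology.inhomogeneousChains.d (Rep.trivial k G A) n).hom := by
    refine Finsupp.lhom_ext fun g a => ?_
    rw [d_single]
    exact (groupHomology.inhomogeneousChains.d_single (A := Rep.trivial k G A) n g a).symm
  rw [h, h]
  exact LinearMap.congr_fun (congrArg ModuleCat.Hom.hom
    (groupHomology.inhomogeneousChains.d_comp_d (Rep.trivial k G A) n)) x

/-- A degenerate cycle is a boundary. -/
theorem mem_range_d_of_mem_degenerate {n m : ℕ} (hm : m ≤ n + 1) {x : chains G A (n + 1)}
    (hx : x ∈ degenerate k G A n m) (hd : d k G A n x = 0) :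
    x ∈ LinearMap.range (d k G A (n + 1)) := by
  induction m generalizing x with
  | zero =>
    have : degenerate k G A n 0 ≤ ⊥ := degenerate_le fun i hi => by omega
    rw [(Submodule.mem_bot k).1 (this hx)]
    exact zero_mem _
  | succ m ih =>
    have h := d_degenMap_add_degenMap_d_sub_mem (by omega) hx
    rw [hd, map_zero, add_zero] at h
    have h' := ih (by omega) h (by rw [map_sub, d_d, map_smul, hd, smul_zero, sub_zero])
    have h'' := sub_mem (LinearMap.mem_range_self (d k G A (n + 1)) (degenMap k A (n + 1) m x)) h'
    rw [sub_sub_cancel] at h''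
    have := Submodule.smul_mem _ ((-1 : k) ^ m) h''
    rwa [smul_smul, ← mul_pow, neg_one_mul, neg_neg, one_pow, one_smul] at this

end Normalization

end BarHomology

namespace BarHomology

section OrderTwo

variable {k : Type} [CommRing k] {A : Type} [AddCommGroup A] [Module k A]

/-- The nontrivial element of the group of order two. -/
abbrev gen : Multiplicative (ZMod 2) := Multiplicative.ofAdd 1

lemma gen_ne_one : gen ≠ 1 := by decide

lemma gen_mul_gen : gen * gen = 1 := by decide

lemma eq_one_of_ne_gen : ∀ g : Multiplicative (ZMod 2), g ≠ gen → g = 1 := by decide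

lemma exists_eq_one_of_ne_const {n : ℕ} {g : Fin n → Multiplicative (ZMod 2)}
    (hg : g ≠ fun _ => gen) : ∃ i, g i = 1 := by
  obtain ⟨i, hi⟩ := Function.ne_iff.1 hg
  exact ⟨i, eq_one_of_ne_gen _ hi⟩

lemma apply_const_of_mem_degenerate {n m : ℕ} {x : chains (Multiplicative (ZMod 2)) A (n + 1)}
    (hx : x ∈ degenerate k (Multiplicative (ZMod 2)) A n m) : x (fun _ => gen) = 0 := by
  have h : degenerate k (Multiplicative (ZMod 2)) A n m ≤
      LinearMap.ker (Finsupp.lapply (R := k) (M := A) fun _ : Fin (n + 1) => gen) := by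
    refine degenerate_le fun i hi y => ?_
    rw [LinearMap.mem_ker, Finsupp.lapply_apply]
    induction y using Finsupp.induction_linear with
    | zero => simp
    | add y z hy hz => simp [hy, hz]
    | single g a =>
      rw [degenMap_single]
      refine Finsupp.single_eq_of_ne fun h => gen_ne_one ?_
      rw [congrFun h ⟨min i n, by omega⟩]
      simp only [degen]
      split_ifs
      · exact extendOne_of_le _ (by omega)
      · rfl
      · omega
  exact h hx

lemma mem_degenerate_of_apply_const {n : ℕ} {x : chains (Multiplicative (ZMod 2)) A (n + 1)}
    (hx : x (fun _ => gen) = 0) : x ∈ degenerate k (Multiplicative (ZMod 2)) A n (n + 1) := by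
  rw [← Finsupp.sum_single x]
  refine sum_mem fun g hg => ?_
  obtain ⟨i, hi⟩ := exists_eq_one_of_ne_const (g := g) (by
    rintro rfl
    exact Finsupp.mem_support_iff.1 hg hx)
  exact single_mem_degenerate g _ i hi

lemma d_mem_degenerate {G : Type} [Group G] {n : ℕ} {x : chains G A (n + 2)}
    (hx : x ∈ degenerate k G A (n + 1) (n + 2)) :
    d k G A (n + 1) x ∈ degenerate k G A n (n + 2) := by
  have h : degenerate k G A (n + 1) (n + 2) ≤
      (degenerate k G A n (n + 2)).comap (d k G A (n + 1)) := by
    refine degenerate_le fun i hi y => ?_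
    exact degenerate_le (fun j hj z => degenMap_mem_degenerate (by omega) z)
      (d_degenMap_mem_degenerate (by omega) y)
  exact h hx

lemma d_single_const_apply_const (n : ℕ) (a : A) :
    d k (Multiplicative (ZMod 2)) A n (Finsupp.single (fun _ => gen) a) (fun _ => gen) =
      (1 + (-1 : k) ^ (n + 1)) • a := by
  have hlast : face (n + 1) (fun _ : Fin (n + 1) => gen) = fun _ => gen := by
    refine (face_succ (Fin.last n) _).trans ?_
    funext i
    exact Fin.contractNth_apply_of_lt _ _ _ _ i.2
  have hmid (j : ℕ) (hj : j ∈ Finset.range n) :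
      ((-1 : k) ^ (j + 1) • Finsupp.single (face (j + 1) fun _ : Fin (n + 1) => gen) a)
        (fun _ => gen) = 0 := by
    rw [Finset.mem_range] at hj
    rw [Finsupp.smul_apply, Finsupp.single_eq_of_ne, smul_zero]
    intro h
    refine gen_ne_one ((congrFun h ⟨j, hj⟩).trans ?_)
    rw [show j + 1 = ((⟨j, by omega⟩ : Fin (n + 1)) : ℕ) + 1 from rfl, face_succ,
      Fin.contractNth_apply_of_eq _ _ _ _ rfl, gen_mul_gen]
  simp only [d_eq_sum_faceMap, faceMap_single]
  rw [Finset.sum_range_succ, Finset.sum_range_succ', hlast, face_zero, Finsupp.add_apply,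
    Finsupp.add_apply, Finsupp.finsetSum_apply, Finset.sum_eq_zero hmid]
  simp [add_smul]

/-- The coefficient of the nondegenerate simplex in a boundary. -/
lemma d_apply_const (n : ℕ) (x : chains (Multiplicative (ZMod 2)) A (n + 2)) :
    d k (Multiplicative (ZMod 2)) A (n + 1) x (fun _ => gen) =
      (1 + (-1 : k) ^ n) • x (fun _ => gen) := by
  set a := x (fun _ => gen) with ha
  have h : d k (Multiplicative (ZMod 2)) A (n + 1) (x - Finsupp.single (fun _ => gen) a)
      (fun _ => gen) = 0 :=
    apply_const_of_mem_degenerate (d_mem_degenerate (mem_degenerate_of_apply_const (by simp [ha])))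
  rw [map_sub, Finsupp.sub_apply, d_single_const_apply_const, sub_eq_zero] at h
  rw [h, pow_succ, pow_succ, mul_assoc, neg_one_mul, neg_neg, mul_one]

lemma mem_range_d_of_apply_const {n : ℕ} {x : chains (Multiplicative (ZMod 2)) A (n + 1)}
    (hd : d k (Multiplicative (ZMod 2)) A n x = 0) (hx : x (fun _ => gen) = 0) :
    x ∈ LinearMap.range (d k (Multiplicative (ZMod 2)) A (n + 1)) :=
  mem_range_d_of_mem_degenerate le_rfl (mem_degenerate_of_apply_const hx) hd

lemma mem_range_d_of_even {n : ℕ} (hn : Even n)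
    {x : chains (Multiplicative (ZMod 2)) A (n + 1)}
    (hd : d k (Multiplicative (ZMod 2)) A n x = 0) {a : A} (hx : x (fun _ => gen) = (2 : k) • a) :
    x ∈ LinearMap.range (d k (Multiplicative (ZMod 2)) A (n + 1)) := by
  have h := mem_range_d_of_apply_const (k := k)
    (x := x - d k (Multiplicative (ZMod 2)) A (n + 1) (Finsupp.single (fun _ => gen) a))
    (by rw [map_sub, hd, d_d, sub_zero])
    (by
      rw [Finsupp.sub_apply, hx, d_apply_const, hn.neg_one_pow, one_add_one_eq_two,
        Finsupp.single_eq_same, sub_self])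
  simpa using add_mem h (LinearMap.mem_range_self (d k (Multiplicative (ZMod 2)) A (n + 1))
    (Finsupp.single (fun _ => gen) a))

lemma two_smul_apply_const {n : ℕ} (hn : Even n)
    {x : chains (Multiplicative (ZMod 2)) A (n + 2)}
    (hd : d k (Multiplicative (ZMod 2)) A (n + 1) x = 0) : (2 : k) • x (fun _ => gen) = 0 := by
  have h := d_apply_const (k := k) n x
  rwa [hd, hn.neg_one_pow, one_add_one_eq_two, Finsupp.zero_apply, eq_comm] at h

end OrderTwo

section Pairing

variable {k : Type} [CommRing k] {G : Type} {A : Type} [AddCommGroup A] [Module k A]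
  {R : Type} [CommRing R] [Algebra k R]

/-- The evaluation of a cochain on the image of a chain under a map of coefficients. -/
noncomputable def pairing (ρ : A →ₗ[k] R) {n : ℕ} (c : (Fin n → G) → R) : chains G A n →ₗ[k] R :=
  Finsupp.lsum k fun g => LinearMap.mulRight k (c g) ∘ₗ ρ

@[simp]
lemma pairing_single (ρ : A →ₗ[k] R) {n : ℕ} (c : (Fin n → G) → R) (g : Fin n → G) (a : A) :
    pairing ρ c (Finsupp.single g a) = ρ a * c g := by
  simp [pairing]

lemma pairing_d [Group G] [Algebra k (ZMod 2)] {n : ℕ} {c : (Fin n → G) → ZMod 2}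
    (ρ : A →ₗ[k] ZMod 2)
    (hc : ∀ g : Fin (n + 1) → G,
      c (fun i => g i.succ) + ∑ j : Fin (n + 1), c (Fin.contractNth j (· * ·) g) = 0)
    (w : chains G A (n + 1)) : pairing ρ c (d k G A n w) = 0 := by
  induction w using Finsupp.induction_linear with
  | zero => simp
  | add x y hx hy => simp [hx, hy]
  | single g a =>
    have hsign (m : ℕ) (z : ZMod 2) : (-1 : k) ^ m • z = z := by
      rcases neg_one_pow_eq_or k m with h | h <;> simp [h]
    rw [d_single]
    simp only [map_add, map_sum, LinearMap.map_smul, pairing_single, hsign]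
    rw [← Finset.mul_sum, ← mul_add, hc, mul_zero]

lemma pairing_chainsMap [Group G] (φ : Multiplicative (ZMod 2) →* G) {n : ℕ} {c : (Fin n → G) → R}
    (hc : ∀ g i, g i = 1 → c g = 0) (ρ : A →ₗ[k] R)
    (x : chains (Multiplicative (ZMod 2)) A n) :
    pairing ρ c (chainsMap k A φ n x) = ρ (x fun _ => gen) * c fun _ => φ gen := by
  induction x using Finsupp.induction_linear with
  | zero => simp
  | add x y hx hy => simp [hx, hy, add_mul]
  | single g a =>
    have : chainsMap k A φ n (Finsupp.single g a) = Finsupp.single (φ ∘ g) a :=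
      Finsupp.mapDomain_single
    rw [this, pairing_single]
    by_cases hg : g = fun _ => gen
    · subst hg
      rw [Finsupp.single_eq_same]
      rfl
    · obtain ⟨i, hi⟩ := exists_eq_one_of_ne_const hg
      rw [hc _ i (by simp [hi]), Finsupp.single_eq_of_ne (Ne.symm hg)]
      simp

end Pairing

section CrossedCup

variable {G : Type} {X : Type} (act : X → G → X) (ξ η : X → G → ZMod 2)

/-- The cup product of `n` copies of the crossed homomorphism `ξ` and one of `η`, both with values
in the functions on the right `G`-set `X`. -/
def crossedCup : (n : ℕ) → X → (Fin (n + 1) → G) → ZMod 2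
  | 0, r, g => η r (g 0)
  | n + 1, r, g => ξ r (g 0) * crossedCup n (act r (g 0)) fun i => g i.succ

variable {act ξ η}

lemma crossedCup_cocycle [Group G] (hact : ∀ r g h, act r (g * h) = act (act r g) h)
    (hξ : ∀ r g h, ξ r (g * h) = ξ r g + ξ (act r g) h)
    (hη : ∀ r g h, η r (g * h) = η r g + η (act r g) h) (n : ℕ) (r : X) (g : Fin (n + 2) → G) :
    crossedCup act ξ η n (act r (g 0)) (fun i => g i.succ) +
      ∑ j : Fin (n + 2), crossedCup act ξ η n r (Fin.contractNth j (· * ·) g) = 0 := by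
  induction n generalizing r with
  | zero =>
    have h₀ : Fin.contractNth 0 (· * ·) g 0 = g 0 * g 1 := rfl
    have h₁ : Fin.contractNth 1 (· * ·) g 0 = g 0 := rfl
    have h₂ : (Fin.succ 0 : Fin 2) = 1 := rfl
    simp only [crossedCup, Nat.reduceAdd, Fin.sum_univ_two, h₀, h₁, h₂, hη]
    generalize η r (g 0) = x
    generalize η (act r (g 0)) (g 1) = y
    revert x y
    decide
  | succ n ih =>
    have h₀ : Fin.contractNth 0 (· * ·) g 0 = g 0 * g 1 := rfl
    have h₀' : (fun i => Fin.contractNth 0 (· * ·) g (Fin.succ i)) =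
        fun i : Fin (n + 1) => g i.succ.succ := rfl
    have h₁ (j : Fin (n + 2)) : Fin.contractNth j.succ (· * ·) g 0 = g 0 := rfl
    have h₁' (j : Fin (n + 2)) : (fun i => Fin.contractNth j.succ (· * ·) g (Fin.succ i)) =
        Fin.contractNth j (· * ·) fun i => g i.succ := by
      funext i
      simp [Fin.contractNth, Fin.val_succ]
    have hih := ih (act r (g 0)) fun i => g i.succ
    rw [Fin.sum_univ_succ]
    simp only [crossedCup, h₀, h₀', h₁, h₁', hξ, hact, ← Finset.mul_sum]
    rw [eq_neg_of_add_eq_zero_right hih]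
    have h₂ : (Fin.succ 0 : Fin (n + 3)) = 1 := rfl
    simp only [h₂]
    generalize crossedCup act ξ η n _ _ = z
    generalize ξ r (g 0) = x
    generalize ξ (act r (g 0)) (g 1) = y
    revert x y z
    decide

lemma crossedCup_eq_zero [Group G] (hξ : ∀ r, ξ r 1 = 0) (hη : ∀ r, η r 1 = 0) {n : ℕ} (r : X)
    {g : Fin (n + 1) → G} {i : Fin (n + 1)} (hi : g i = 1) : crossedCup act ξ η n r g = 0 := by
  induction n generalizing r with
  | zero =>
    obtain rfl := Fin.fin_one_eq_zero i
    simp [crossedCup, hi, hη]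
  | succ n ih =>
    rcases Fin.eq_zero_or_eq_succ i with rfl | ⟨j, rfl⟩
    · simp [crossedCup, hi, hξ]
    · rw [crossedCup, ih (i := j) _ hi, mul_zero]

lemma crossedCup_const {t : G} (ht : ∀ r, act r t = r) (n : ℕ) (r : X) :
    crossedCup act ξ η n r (fun _ => t) = ξ r t ^ n * η r t := by
  induction n with
  | zero => simp [crossedCup]
  | succ n ih => rw [crossedCup, ht, ih, pow_succ', mul_assoc]

end CrossedCup

end BarHomology

namespace BarHomology

section AlternatingGroup

open Equiv Equiv.Perm

/-- The right action of `A₄` on the three partitions of `Fin 4` into two pairs, where `r` stands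
for the partition in which `0` is paired with `r + 1`. -/
def pairAct (r : Fin 3) (g : alternatingGroup (Fin 4)) : Fin 3 :=
  Fin.ofNat 3 ((((g⁻¹ : Perm (Fin 4)) 0 : ℕ) ^^^ ((g⁻¹ : Perm (Fin 4)) r.succ : ℕ)) + 2)

/-- Whether the element `g` moves the pair that contains `0` to the pair that does not. -/
def pairSwap (r : Fin 3) (g : alternatingGroup (Fin 4)) : ZMod 2 :=
  if (g⁻¹ : Perm (Fin 4)) 0 = 0 ∨ (g⁻¹ : Perm (Fin 4)) r.succ = 0 then 0 else 1

lemma pairAct_mul : ∀ r g h, pairAct r (g * h) = pairAct (pairAct r g) h := by decide +kernel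

lemma pairAct_one : ∀ r, pairAct r 1 = r := by decide +kernel

lemma pairAct_add_one : ∀ r g, pairAct (r + 1) g = pairAct r g + 1 := by decide +kernel

lemma pairSwap_mul : ∀ r g h, pairSwap r (g * h) = pairSwap r g + pairSwap (pairAct r g) h := by
  decide +kernel

lemma pairSwap_one : ∀ r, pairSwap r 1 = 0 := by decide +kernel

lemma pairAct_of_mul_self : ∀ t : alternatingGroup (Fin 4), t * t = 1 → ∀ r, pairAct r t = r := by
  decide +kernel

lemma sum_pairSwap_mul_pairSwap : ∀ t : alternatingGroup (Fin 4), t * t = 1 → t ≠ 1 →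
    ∑ r, pairSwap r t * pairSwap (r + 1) t = 1 := by
  decide +kernel

lemma exists_commutatorElement_eq : ∀ t : alternatingGroup (Fin 4), t * t = 1 →
    ∃ g h : alternatingGroup (Fin 4), g * h * g⁻¹ * h⁻¹ = t := by
  decide +kernel

lemma exists_conj_eq_and_commute : ∀ a : alternatingGroup (Fin 4), a * a = 1 →
    ∃ b c : alternatingGroup (Fin 4), c * a = b * c ∧ c * b = a * b * c ∧ b * a = a * b ∧
      b * b = 1 := by
  decide +kernel

lemma pairAct_bijective (g : alternatingGroup (Fin 4)) :
    Function.Bijective fun r => pairAct r g :=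
  Function.bijective_iff_has_inverse.2 ⟨fun r => pairAct r g⁻¹,
    fun r => by simp only [← pairAct_mul, mul_inv_cancel, pairAct_one],
    fun r => by simp only [← pairAct_mul, inv_mul_cancel, pairAct_one]⟩

/-- A normalized mod `2` cocycle on `A₄` of degree `n + 1`: the transfer of the class
`x ^ n * y` from the Klein four-group. -/
def pairCocycle (n : ℕ) (g : Fin (n + 1) → alternatingGroup (Fin 4)) : ZMod 2 :=
  ∑ r, crossedCup pairAct pairSwap (fun r => pairSwap (r + 1)) n r g

lemma pairCocycle_cocycle (n : ℕ) (g : Fin (n + 2) → alternatingGroup (Fin 4)) :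
    pairCocycle n (fun i => g i.succ) +
      ∑ j : Fin (n + 2), pairCocycle n (Fin.contractNth j (· * ·) g) = 0 := by
  simp only [pairCocycle]
  rw [Finset.sum_comm, ← (pairAct_bijective (g 0)).sum_comp, ← Finset.sum_add_distrib]
  refine Finset.sum_eq_zero fun r _ => crossedCup_cocycle pairAct_mul pairSwap_mul ?_ n r g
  intro r g h
  rw [pairSwap_mul, pairAct_add_one]

lemma pairCocycle_eq_zero {n : ℕ} (g : Fin (n + 1) → alternatingGroup (Fin 4)) (i : Fin (n + 1))
    (hi : g i = 1) : pairCocycle n g = 0 :=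
  Finset.sum_eq_zero fun r _ =>
    crossedCup_eq_zero pairSwap_one (fun r => pairSwap_one (r + 1)) r hi

lemma pairCocycle_const {n : ℕ} (hn : n ≠ 0) {t : alternatingGroup (Fin 4)} (ht : t * t = 1)
    (ht' : t ≠ 1) : pairCocycle n (fun _ => t) = 1 := by
  have hpow (z : ZMod 2) : z ^ n = z := by
    obtain rfl | rfl : z = 0 ∨ z = 1 := by revert z; decide
    · exact zero_pow hn
    · exact one_pow n
  rw [← sum_pairSwap_mul_pairSwap t ht ht']
  refine Finset.sum_congr rfl fun r _ => ?_
  rw [crossedCup_const (pairAct_of_mul_self t ht), hpow]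

end AlternatingGroup

section Detection

variable {φ : Multiplicative (ZMod 2) →* alternatingGroup (Fin 4)}

lemma map_gen_mul_map_gen {G : Type} [Group G] (φ : Multiplicative (ZMod 2) →* G) :
    φ gen * φ gen = 1 := by
  rw [← map_mul, gen_mul_gen, map_one]

lemma map_gen_ne_one (hφ : Function.Injective φ) : φ gen ≠ 1 := by
  rw [← map_one φ]
  exact hφ.ne gen_ne_one

/-- Boundaries in the bar complex of `A₄` only involve the nondegenerate simplex of a subgroup of
order two with coefficients that vanish mod `2`. -/
lemma map_apply_const_eq_zero {k : Type} [CommRing k] [Algebra k (ZMod 2)]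
    {A : Type} [AddCommGroup A] [Module k A]
    (hφ : Function.Injective φ) (ρ : A →ₗ[k] ZMod 2) {n : ℕ}
    {x : chains (Multiplicative (ZMod 2)) A (n + 2)}
    (hx : chainsMap k A φ (n + 2) x ∈
      LinearMap.range (d k (alternatingGroup (Fin 4)) A (n + 2))) :
    ρ (x fun _ => gen) = 0 := by
  obtain ⟨w, hw⟩ := hx
  have h := pairing_chainsMap φ pairCocycle_eq_zero ρ x
  rwa [← hw, pairing_d ρ (pairCocycle_cocycle (n + 1)),
    pairCocycle_const n.succ_ne_zero (map_gen_mul_map_gen φ) (map_gen_ne_one hφ), mul_one,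
    eq_comm] at h

variable {G G' : Type} [Group G] [Group G']

/-- The reduction mod `m` of integral chains. -/
noncomputable def reduceMod (G : Type) (m n : ℕ) : chains G ℤ n →ₗ[ℤ] chains G (ZMod m) n :=
  Finsupp.mapRange.linearMap (Algebra.linearMap ℤ (ZMod m))

@[simp]
lemma reduceMod_single {G : Type} (m n : ℕ) (g : Fin n → G) (a : ℤ) :
    reduceMod G m n (Finsupp.single g a) = Finsupp.single g (a : ZMod m) := by
  simp [reduceMod]

lemma reduceMod_apply {G : Type} (m n : ℕ) (x : chains G ℤ n) (g : Fin n → G) :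
    reduceMod G m n x g = (x g : ZMod m) := by
  simp [reduceMod]

lemma d_reduceMod (m n : ℕ) (x : chains G ℤ (n + 1)) :
    d ℤ G (ZMod m) n (reduceMod G m (n + 1) x) = reduceMod G m n (d ℤ G ℤ n x) := by
  induction x using Finsupp.induction_linear with
  | zero => simp
  | add x y hx hy => simp only [map_add, hx, hy]
  | single g a =>
    simp only [reduceMod_single, d_single, map_add, map_sum, LinearMap.map_smul]

lemma chainsMap_reduceMod (φ : G →* G') (m n : ℕ) (x : chains G ℤ n) :
    chainsMap ℤ (ZMod m) φ n (reduceMod G m n x) = reduceMod G' m n (chainsMap ℤ ℤ φ n x) := by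
  induction x using Finsupp.induction_linear with
  | zero => simp
  | add x y hx hy => simp only [map_add, hx, hy]
  | single g a => simp [chainsMap]

lemma reduceMod_surjective {G : Type} (m n : ℕ) : Function.Surjective (reduceMod G m n) :=
  Finsupp.mapRange_surjective _ (by simp) (ZMod.intCast_surjective)

lemma exists_eq_smul_of_reduceMod_eq_zero {G : Type} {m n : ℕ} {x : chains G ℤ n}
    (hx : reduceMod G m n x = 0) : ∃ y : chains G ℤ n, x = (m : ℤ) • y := by
  refine ⟨x.mapRange (· / (m : ℤ)) (by simp), Finsupp.ext fun g => ?_⟩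
  have h := reduceMod_apply m n x g
  rw [hx, Finsupp.zero_apply, eq_comm, ZMod.intCast_zmod_eq_zero_iff_dvd] at h
  simp [Int.mul_ediv_cancel' h]

/-- The Bockstein argument for coefficients `ℤ/4`. -/
lemma apply_const_eq_zero_of_even (hφ : Function.Injective φ) {n : ℕ} (hn : Even n)
    {x : chains (Multiplicative (ZMod 2)) (ZMod 4) (n + 4)}
    (hd : d ℤ (Multiplicative (ZMod 2)) (ZMod 4) (n + 3) x = 0)
    (hx : chainsMap ℤ (ZMod 4) φ (n + 4) x ∈
      LinearMap.range (d ℤ (alternatingGroup (Fin 4)) (ZMod 4) (n + 4))) :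
    x (fun _ => gen) = 0 := by
  obtain ⟨w, hw⟩ := hx
  obtain ⟨X, rfl⟩ := reduceMod_surjective 4 _ x
  obtain ⟨W, rfl⟩ := reduceMod_surjective 4 _ w
  rw [d_reduceMod] at hd hw
  rw [chainsMap_reduceMod, eq_comm, ← sub_eq_zero, ← map_sub] at hw
  obtain ⟨Y, hY⟩ := exists_eq_smul_of_reduceMod_eq_zero hd
  obtain ⟨Z, hZ⟩ := exists_eq_smul_of_reduceMod_eq_zero hw
  have hYZ : chainsMap ℤ ℤ φ (n + 3) Y = d ℤ (alternatingGroup (Fin 4)) ℤ (n + 3) Z := by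
    have h4 : (4 : ℤ) • chainsMap ℤ ℤ φ (n + 3) Y =
        (4 : ℤ) • d ℤ (alternatingGroup (Fin 4)) ℤ (n + 3) Z := by
      have h := LinearMap.congr_fun (chainsMap_comm (k := ℤ) (A := ℤ) φ (n + 3)) X
      rw [LinearMap.comp_apply, LinearMap.comp_apply, hY, eq_add_of_sub_eq hZ, map_add, d_d,
        add_zero, LinearMap.map_smul, LinearMap.map_smul] at h
      exact h.symm
    exact smul_right_injective _ (by norm_num : (4 : ℤ) ≠ 0) h4
  have hYeven : ((Y fun _ => gen : ℤ) : ZMod 2) = 0 :=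
    map_apply_const_eq_zero hφ (Algebra.linearMap ℤ (ZMod 2)) ⟨Z, hYZ.symm⟩
  have hXY : (2 : ℤ) * X (fun _ => gen) = 4 * Y fun _ => gen := by
    have h := d_apply_const (k := ℤ) (n + 2) X
    rw [hY, Even.neg_one_pow (by simpa [parity_simps] using hn)] at h
    simpa using h.symm
  obtain ⟨y, hy⟩ := (ZMod.intCast_zmod_eq_zero_iff_dvd _ 2).1 hYeven
  rw [reduceMod_apply, ZMod.intCast_zmod_eq_zero_iff_dvd]
  exact ⟨y, by push_cast at hy ⊢; linarith⟩

end Detection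

end BarHomology

namespace BarHomology

section InducedMap

variable {k : Type} [CommRing k] {G G' : Type} [Group G] [Group G'] {A : Type} [AddCommGroup A]
  [Module k A]

lemma inducedMap_injective_of_forall {φ : G →* G'} {n : ℕ}
    (h : ∀ x ∈ cycles k G A n, chainsMap k A φ n x ∈ LinearMap.range (d k G' A n) →
      x ∈ LinearMap.range (d k G A n)) : Function.Injective (inducedMap k A φ n) := by
  rw [injective_iff_map_eq_zero]
  intro x
  obtain ⟨x, rfl⟩ := Submodule.Quotient.mk_surjective _ x
  intro hx
  rw [inducedMap, Submodule.mapQ_apply, Submodule.Quotient.mk_eq_zero] at hx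
  exact (Submodule.Quotient.mk_eq_zero _).2 (h x x.2 hx)

lemma inducedMap_eq_zero_of_forall {φ : G →* G'} {n : ℕ}
    (h : ∀ x ∈ cycles k G A n, chainsMap k A φ n x ∈ LinearMap.range (d k G' A n)) :
    inducedMap k A φ n = 0 := by
  ext x
  exact (Submodule.Quotient.mk_eq_zero _).2 (h x x.2)

lemma d_single_pair (g h : G) (a : A) :
    d k G A 1 (Finsupp.single ![g, h] a) =
      Finsupp.single ![h] a - Finsupp.single ![g * h] a + Finsupp.single ![g] a := by
  have h₀ : Fin.contractNth 0 (· * ·) ![g, h] = ![g * h] := by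
    funext i; fin_cases i; rfl
  have h₁ : Fin.contractNth 1 (· * ·) ![g, h] = ![g] := by
    funext i; fin_cases i; rfl
  have h₂ : (fun i => ![g, h] (Fin.succ i)) = ![h] := by
    funext i; fin_cases i; rfl
  simp only [d_single, Nat.reduceAdd, Fin.sum_univ_two, h₀, h₁, h₂]
  simp
  abel

lemma single_mul_sub_mem_range_d (g h : G) (a : A) :
    Finsupp.single ![g * h] a - (Finsupp.single ![g] a + Finsupp.single ![h] a) ∈
      LinearMap.range (d k G A 1) :=
  ⟨-Finsupp.single ![g, h] a, by rw [map_neg, d_single_pair]; abel⟩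

/-- The class of a commutator in the first homology vanishes. -/
lemma single_commutator_mem_range_d (g h : G) (a : A) :
    Finsupp.single ![g * h * g⁻¹ * h⁻¹] a ∈ LinearMap.range (d k G A 1) := by
  let f : G →* Multiplicative (chains G A 1 ⧸ LinearMap.range (d k G A 1)) :=
    MonoidHom.mk' (fun g => Multiplicative.ofAdd (Submodule.Quotient.mk (Finsupp.single ![g] a)))
      fun g h => congrArg Multiplicative.ofAdd
        ((Submodule.Quotient.eq _).2 (single_mul_sub_mem_range_d g h a))
  have hf : f (g * h * g⁻¹ * h⁻¹) = 1 := by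
    simp [mul_comm (f g)]
  exact (Submodule.Quotient.mk_eq_zero _).1 hf

lemma single_two_mem_range_d (g h l : G) (a : A) :
    Finsupp.single ![h, l] a + Finsupp.single ![g, h * l] a -
      (Finsupp.single ![g * h, l] a + Finsupp.single ![g, h] a) ∈ LinearMap.range (d k G A 2) := by
  refine ⟨Finsupp.single ![g, h, l] a, ?_⟩
  have h₀ : Fin.contractNth 0 (· * ·) ![g, h, l] = ![g * h, l] := by
    funext i; fin_cases i <;> rfl
  have h₁ : Fin.contractNth 1 (· * ·) ![g, h, l] = ![g, h * l] := by
    funext i; fin_cases i <;> rfl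
  have h₂ : Fin.contractNth 2 (· * ·) ![g, h, l] = ![g, h] := by
    funext i; fin_cases i <;> rfl
  have h₃ : (fun i => ![g, h, l] (Fin.succ i)) = ![h, l] := by
    funext i; fin_cases i <;> rfl
  simp only [d_single, Nat.reduceAdd, Fin.sum_univ_three, h₀, h₁, h₂, h₃]
  simp [Odd.neg_one_pow (by decide : Odd 3)]
  abel

end InducedMap

section TwoCocycle

variable {G Q : Type} [Group G] [AddCommGroup Q] {f : G → G → Q}

lemma twoCocycle_one_left (hf : ∀ g h l, f h l + f g (h * l) = f (g * h) l + f g h) (g : G) :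
    f 1 g = f 1 1 := by
  simpa using hf 1 1 g

lemma twoCocycle_one_right (hf : ∀ g h l, f h l + f g (h * l) = f (g * h) l + f g h) (g : G) :
    f g 1 = f 1 1 := by
  simpa using (hf g 1 1).symm

lemma two_smul_twoCocycle_conj (hf : ∀ g h l, f h l + f g (h * l) = f (g * h) l + f g h)
    (h4 : ∀ q : Q, (4 : ℤ) • q = 0) {a b c : G} (ha : a * a = 1) (hb : b * b = 1)
    (hc : c * a = b * c) : (2 : ℤ) • f b b = (2 : ℤ) • f a a := by
  have h₁ := hf b b c
  have h₂ := hf c a a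
  have h₃ := hf b c a
  rw [hb, twoCocycle_one_left hf] at h₁
  rw [ha, hc, twoCocycle_one_right hf] at h₂
  rw [hc] at h₃
  linear_combination (norm := module) (-2 : ℤ) • h₁ - (2 : ℤ) • h₂ + (2 : ℤ) • h₃ +
    h4 (f b c) - h4 (f c a)

lemma two_smul_twoCocycle_mul (hf : ∀ g h l, f h l + f g (h * l) = f (g * h) l + f g h)
    (h4 : ∀ q : Q, (4 : ℤ) • q = 0) {a b : G} (ha : a * a = 1) (hb : b * b = 1)
    (hab : b * a = a * b) :
    (2 : ℤ) • f (a * b) (a * b) + (2 : ℤ) • f 1 1 = (2 : ℤ) • f a a + (2 : ℤ) • f b b := by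
  have h₁ := hf a b (a * b)
  have h₂ := hf b b a
  have h₃ := hf a a b
  have h₄ := hf b a a
  have h₅ := hf a b a
  rw [← hab, ← mul_assoc b b a, hb, one_mul, hab] at h₁
  rw [hb, hab, twoCocycle_one_left hf] at h₂
  rw [ha, twoCocycle_one_left hf] at h₃
  rw [ha, hab, twoCocycle_one_right hf] at h₄
  rw [hab] at h₅
  linear_combination (norm := module) (-2 : ℤ) • h₁ + (2 : ℤ) • h₂ + h₃ + h₄ - h₅ -
    h4 (f a b) + h4 (f 1 1)

end TwoCocycle

section Vanishing

/-- A two-cocycle on the alternating group with values killed by four becomes trivial, after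
doubling, on the involutions. -/
lemma two_smul_twoCocycle_involution {Q : Type} [AddCommGroup Q]
    {f : alternatingGroup (Fin 4) → alternatingGroup (Fin 4) → Q}
    (hf : ∀ g h l, f h l + f g (h * l) = f (g * h) l + f g h)
    (h4 : ∀ q : Q, (4 : ℤ) • q = 0) {a : alternatingGroup (Fin 4)} (ha : a * a = 1) :
    (2 : ℤ) • f a a + (2 : ℤ) • f 1 1 = 0 := by
  obtain ⟨b, c, hca, hcb, hba, hb⟩ := exists_conj_eq_and_commute a ha
  have hab : a * b * (a * b) = 1 := by
    rw [mul_assoc, ← mul_assoc b a b, hba, mul_assoc a b b, hb, mul_one, ha]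
  have h₁ := two_smul_twoCocycle_conj hf h4 ha hb hca
  have h₂ := two_smul_twoCocycle_conj hf h4 hb hab hcb
  have h₃ := two_smul_twoCocycle_mul hf h4 ha hb hba
  linear_combination (norm := module) h₂ - h₃ + h4 (f 1 1)

variable {φ : Multiplicative (ZMod 2) →* alternatingGroup (Fin 4)}

lemma chainsMap_one_mem_range_d {k : Type} [CommRing k] {A : Type} [AddCommGroup A] [Module k A]
    (x : chains (Multiplicative (ZMod 2)) A 1) :
    chainsMap k A φ 1 x ∈ LinearMap.range (d k (alternatingGroup (Fin 4)) A 1) := by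
  induction x using Finsupp.induction_linear with
  | zero => simp
  | add x y hx hy => rw [map_add]; exact add_mem hx hy
  | single g a =>
    have hg : φ (g 0) * φ (g 0) = 1 := by
      rw [← map_mul, show g 0 * g 0 = 1 by generalize g 0 = t; revert t; decide, map_one]
    obtain ⟨u, v, huv⟩ := exists_commutatorElement_eq _ hg
    have h := single_commutator_mem_range_d (k := k) u v a
    rw [huv] at h
    have hφg : φ ∘ g = ![φ (g 0)] := by funext i; fin_cases i; rfl
    rwa [chainsMap, Finsupp.lmapDomain_apply, Finsupp.mapDomain_single, hφg]

lemma single_involution_mem_range_d {t : alternatingGroup (Fin 4)} (ht : t * t = 1) {a : ZMod 4}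
    (ha : (2 : ℤ) • a = 0) :
    Finsupp.single ![t, t] a + Finsupp.single ![1, 1] a ∈
      LinearMap.range (d ℤ (alternatingGroup (Fin 4)) (ZMod 4) 2) := by
  obtain ⟨b, rfl⟩ : ∃ b : ZMod 4, a = (2 : ℤ) • b := by revert a; decide
  have h := two_smul_twoCocycle_involution
    (f := fun g h => (Submodule.Quotient.mk (Finsupp.single ![g, h] b) :
      chains (alternatingGroup (Fin 4)) (ZMod 4) 2 ⧸
        LinearMap.range (d ℤ (alternatingGroup (Fin 4)) (ZMod 4) 2)))
    (fun g h l => (Submodule.Quotient.eq _).2 (single_two_mem_range_d g h l b))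
    (fun q => by
      obtain ⟨x, rfl⟩ := Submodule.Quotient.mk_surjective _ q
      rw [← Submodule.Quotient.mk_smul, Submodule.Quotient.mk_eq_zero]
      have hx : (4 : ℤ) • x = 0 := Finsupp.ext fun g =>
        (by decide : ∀ y : ZMod 4, (4 : ℤ) • y = 0) (x g)
      exact hx ▸ zero_mem _) ht
  rw [← Submodule.Quotient.mk_smul, ← Submodule.Quotient.mk_smul, ← Submodule.Quotient.mk_add,
    Submodule.Quotient.mk_eq_zero, Finsupp.smul_single, Finsupp.smul_single] at h
  exact h

lemma chainsMap_two_mem_range_d {x : chains (Multiplicative (ZMod 2)) (ZMod 4) 2}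
    (hd : d ℤ (Multiplicative (ZMod 2)) (ZMod 4) 1 x = 0) :
    chainsMap ℤ (ZMod 4) φ 2 x ∈
      LinearMap.range (d ℤ (alternatingGroup (Fin 4)) (ZMod 4) 2) := by
  have ha := two_smul_apply_const (n := 0) (by simp) hd
  set a := x fun _ => gen with hxa
  have hgen : ![gen, gen] = fun _ => gen := by funext i; fin_cases i <;> rfl
  let e : chains (Multiplicative (ZMod 2)) (ZMod 4) 2 :=
    Finsupp.single ![gen, gen] a + Finsupp.single ![1, 1] a
  have he : d ℤ (Multiplicative (ZMod 2)) (ZMod 4) 1 e = 0 := by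
    rw [map_add, d_single_pair, d_single_pair, gen_mul_gen, mul_one]
    have : Finsupp.single ![gen] a + Finsupp.single ![gen] a = 0 := by
      rw [← Finsupp.single_add, ← two_zsmul, ha, Finsupp.single_zero]
    linear_combination (norm := module) this
  have hne : ![1, 1] ≠ fun _ : Fin 2 => gen := fun h => gen_ne_one (congrFun h 0).symm
  have hsub : x - e ∈ LinearMap.range (d ℤ (Multiplicative (ZMod 2)) (ZMod 4) 2) :=
    mem_range_d_of_apply_const (by rw [map_sub, hd, he, sub_zero]) (by simp [e, hne, hgen, hxa])
  obtain ⟨y, hy⟩ := hsub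
  have hx : chainsMap ℤ (ZMod 4) φ 2 x =
      d ℤ _ _ 2 (chainsMap ℤ (ZMod 4) φ 3 y) + chainsMap ℤ (ZMod 4) φ 2 e := by
    rw [← LinearMap.comp_apply, chainsMap_comm, LinearMap.comp_apply, hy, ← map_add,
      sub_add_cancel]
  rw [hx]
  refine add_mem (LinearMap.mem_range_self _ _) ?_
  convert single_involution_mem_range_d (map_gen_mul_map_gen φ) ha
  simp only [e, chainsMap, map_add, Finsupp.lmapDomain_apply, Finsupp.mapDomain_single]
  congr 2
  · funext i; fin_cases i <;> rfl
  · funext i; fin_cases i <;> simp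

end Vanishing

section Injectivity

variable {φ : Multiplicative (ZMod 2) →* alternatingGroup (Fin 4)}

lemma inducedMap_int_injective (hφ : Function.Injective φ) (n : ℕ) :
    Function.Injective (inducedMap ℤ ℤ φ (n + 2)) := by
  refine inducedMap_injective_of_forall fun x hd hx => ?_
  rcases Nat.even_or_odd n with hn | hn
  · exact mem_range_d_of_apply_const hd
      ((smul_eq_zero.1 (two_smul_apply_const hn hd)).resolve_left two_ne_zero)
  · have h : ((x fun _ => gen : ℤ) : ZMod 2) = 0 :=
      map_apply_const_eq_zero hφ (Algebra.linearMap ℤ (ZMod 2)) hx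
    obtain ⟨a, ha⟩ := (ZMod.intCast_zmod_eq_zero_iff_dvd _ 2).1 h
    exact mem_range_d_of_even hn.add_one hd ha

lemma inducedMap_zmod_two_injective (hφ : Function.Injective φ) (n : ℕ) :
    Function.Injective (inducedMap ℤ (ZMod 2) φ (n + 2)) :=
  inducedMap_injective_of_forall fun _ hd hx =>
    mem_range_d_of_apply_const hd (map_apply_const_eq_zero hφ LinearMap.id hx)

lemma inducedMap_zmod_three_injective (φ : Multiplicative (ZMod 2) →* alternatingGroup (Fin 4))
    (n : ℕ) : Function.Injective (inducedMap ℤ (ZMod 3) φ (n + 2)) := by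
  refine inducedMap_injective_of_forall fun x hd _ => ?_
  rcases Nat.even_or_odd n with hn | hn
  · exact mem_range_d_of_apply_const hd
      ((by decide : ∀ p : ZMod 3, (2 : ℤ) • p = 0 → p = 0) _ (two_smul_apply_const hn hd))
  · exact mem_range_d_of_even hn.add_one hd
      ((by decide : ∀ p : ZMod 3, p = (2 : ℤ) • (2 * p)) _)

lemma exists_eq_two_smul_of_castHom_eq_zero : ∀ p : ZMod 4,
    ZMod.castHom (by decide : 2 ∣ 4) (ZMod 2) p = 0 → ∃ a, p = (2 : ℤ) • a := by
  decide

lemma inducedMap_zmod_four_injective (hφ : Function.Injective φ) {n : ℕ} (hn₀ : n ≠ 0) :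
    Function.Injective (inducedMap ℤ (ZMod 4) φ (n + 2)) := by
  refine inducedMap_injective_of_forall fun x hd hx => ?_
  rcases Nat.even_or_odd n with hn | hn
  · obtain ⟨m, rfl⟩ : ∃ m, n = m + 2 := ⟨n - 2, by obtain ⟨r, rfl⟩ := hn; omega⟩
    exact mem_range_d_of_apply_const hd
      (apply_const_eq_zero_of_even hφ ((Nat.even_add.1 hn).2 even_two) hd hx)
  · obtain ⟨a, ha⟩ := exists_eq_two_smul_of_castHom_eq_zero _ (map_apply_const_eq_zero hφ
      (ZMod.castHom (by decide : 2 ∣ 4) (ZMod 2)).toAddMonoidHom.toIntLinearMap hx)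
    exact mem_range_d_of_even hn.add_one hd ha

end Injectivity

end BarHomology

/-- An inclusion `ℤ/2 → A₄`: with trivial coefficients `ℤ`, `ℤ/2`, `ℤ/3` it induces an
injection on homology in degrees `≥ 2` and the zero map on `H₁`; with trivial coefficients
`ℤ/4` the same holds in degrees `≠ 2`, while on `H₂` it induces the zero map. -/
theorem induced_Z2_to_A4
    (φ : Multiplicative (ZMod 2) →* ↥(alternatingGroup (Fin 4)))
    (hφ : Function.Injective φ) :
    (∀ q : ℕ, 2 ≤ q →
      Function.Injective (inducedMap ℤ ℤ φ q) ∧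
      Function.Injective (inducedMap ℤ (ZMod 2) φ q) ∧
      Function.Injective (inducedMap ℤ (ZMod 3) φ q)) ∧
    (inducedMap ℤ ℤ φ 1 = 0 ∧
      inducedMap ℤ (ZMod 2) φ 1 = 0 ∧
      inducedMap ℤ (ZMod 3) φ 1 = 0) ∧
    (∀ q : ℕ, 2 ≤ q → q ≠ 2 → Function.Injective (inducedMap ℤ (ZMod 4) φ q)) ∧
    inducedMap ℤ (ZMod 4) φ 1 = 0 ∧
    inducedMap ℤ (ZMod 4) φ 2 = 0 := by
  have h₁ : ∀ (A : Type) [AddCommGroup A] [Module ℤ A], inducedMap ℤ A φ 1 = 0 :=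
    fun A _ _ => inducedMap_eq_zero_of_forall fun x _ => chainsMap_one_mem_range_d x
  refine ⟨fun q hq => ?_, ⟨h₁ ℤ, h₁ (ZMod 2), h₁ (ZMod 3)⟩, fun q hq hq₂ => ?_, h₁ (ZMod 4),
    inducedMap_eq_zero_of_forall fun x hx => chainsMap_two_mem_range_d hx⟩
  · obtain ⟨n, rfl⟩ := Nat.exists_eq_add_of_le' hq
    exact ⟨inducedMap_int_injective hφ n, inducedMap_zmod_two_injective hφ n,
      inducedMap_zmod_three_injective φ n⟩
  · obtain ⟨n, rfl⟩ := Nat.exists_eq_add_of_le' hq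
    exact inducedMap_zmod_four_injective hφ (by omega)
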